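/- arXiv:1312.7353 — 4 statements merged into one kernel-verified Lean document; each statement's English description precedes it below -/
import Mathlib

section
/- Fix integers n, d ≥ 1. Let L be a countable type, let w be a probability distribution on L, and for each λ ∈ L, each a ∈ 𝒜_n and b ∈ ℬ_n, let P_λ(·,·|a,b) be a probability distribution on pairs (x,y) ∈ {0,...,d} × {0,...,d}. Assume each P_λ is no-signalling: Σ_y P_λ(x,y|a,b) does not depend on b (call it P_λ(x|a)) and Σ_x P_λ(x,y|a,b) does not depend on a. Define the averaged distribution P(x,y|a,b) = Σ_{λ∈L} w(λ)·P_λ(x,y|a,b). Then Σ_{λ∈L} w(λ) · Σ_{x=0}^{d−1} |P_λ(x|a=0) − 1/d| ≤ (d/2) · I_{n,d}(P). -/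
/-- The set of measurement settings `𝒜_n = {0, 2, 4, …, 2n−2}`. -/
def settingsA (n : ℕ) : Finset ℕ := (Finset.range n).image (fun i => 2 * i)

/-- The set of measurement settings `ℬ_n = {1, 3, 5, …, 2n−1}`. -/
def settingsB (n : ℕ) : Finset ℕ := (Finset.range n).image (fun i => 2 * i + 1)

/-- The chained-Bell expression
`I_{n,d}(P) = 2n − Σ_{x<d} P(x, x⊕1 | 0, 2n−1) − Σ_{a∈𝒜_n, b∈ℬ_n, |a−b|=1} Σ_{x<d} P(x,x|a,b)`,
where `P a b x y` denotes the conditional probability `P(x,y|a,b)` of outcomes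
`x, y ∈ {0,…,d}` given settings `a, b`, and `⊕` is addition modulo `d`. -/
noncomputable def chainedBell (n d : ℕ) (P : ℕ → ℕ → ℕ → ℕ → ℝ) : ℝ :=
  2 * n - (∑ x ∈ Finset.range d, P 0 (2 * n - 1) x ((x + 1) % d))
    - ∑ a ∈ settingsA n, ∑ b ∈ settingsB n,
        if a + 1 = b ∨ b + 1 = a then ∑ x ∈ Finset.range d, P a b x x else 0

open Finset

/-- The sum of absolute deviations from the mean of `d` numbers in `[m, M]` is at most
`d * (M - m) / 2`. -/
lemma sum_abs_sub_mean_le {ι : Type*} (s : Finset ι) (f : ι → ℝ) {c m M : ℝ}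
    (hc : ∑ x ∈ s, f x = #s * c) (hm : ∀ x ∈ s, m ≤ f x) (hM : ∀ x ∈ s, f x ≤ M) :
    ∑ x ∈ s, |f x - c| ≤ #s * (M - m) / 2 := by
  rcases s.eq_empty_or_nonempty with rfl | hs
  · simp
  have hcard : (0 : ℝ) < #s := by exact_mod_cast hs.card_pos
  have hmc : m ≤ c := by
    have := card_nsmul_le_sum s f m hm
    rw [nsmul_eq_mul, hc] at this
    exact le_of_mul_le_mul_left this hcard
  have hcM : c ≤ M := by
    have := sum_le_card_nsmul s f M hM
    rw [nsmul_eq_mul, hc] at this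
    exact le_of_mul_le_mul_left this hcard
  rcases (hmc.trans hcM).eq_or_lt with rfl | hlt
  · refine (sum_eq_zero fun x hx => ?_).le.trans (by simp)
    rw [abs_eq_zero]
    linarith [hm x hx, hM x hx]
  have key : ∀ x ∈ s, (M - m) * |f x - c| ≤
      f x * (M + m - 2 * c) + (M * (c - m) - m * (M - c)) := by
    intro x hx
    rcases abs_cases (f x - c) with ⟨h, -⟩ | ⟨h, -⟩ <;> rw [h]
    · nlinarith [mul_nonneg (sub_nonneg.2 (hM x hx)) (sub_nonneg.2 hmc)]
    · nlinarith [mul_nonneg (sub_nonneg.2 (hm x hx)) (sub_nonneg.2 hcM)]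
  have hsum := sum_le_sum key
  rw [← mul_sum, sum_add_distrib, ← sum_mul, hc, sum_const, nsmul_eq_mul] at hsum
  refine le_of_mul_le_mul_left (hsum.trans ?_) (sub_pos.2 hlt)
  nlinarith [mul_nonneg hcard.le (sq_nonneg (M + m - 2 * c))]

/-- Two values of a function on a cycle differ by at most half of its total variation. -/
lemma abs_sub_le_half_cyclic_variation (f : ℕ → ℝ) {d i j : ℕ} (hi : i < d) (hj : j < d) :
    |f i - f j| ≤ (∑ x ∈ range d, |f x - f ((x + 1) % d)|) / 2 := by
  wlog hij : i ≤ j generalizing i j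
  · rw [abs_sub_comm]
    exact this hj hi (le_of_not_ge hij)
  obtain ⟨k, rfl⟩ : ∃ k, d = k + 1 := ⟨d - 1, by omega⟩
  have hD : ∑ x ∈ range (k + 1), |f x - f ((x + 1) % (k + 1))| =
      ∑ x ∈ range k, |f x - f (x + 1)| + |f k - f 0| := by
    rw [sum_range_succ, Nat.mod_self]
    congr 1
    refine sum_congr rfl fun x hx => ?_
    rw [Nat.mod_eq_of_lt (by have := mem_range.1 hx; omega)]
  have h₁ := dist_le_Ico_sum_dist f (Nat.zero_le i)
  have h₂ := dist_le_Ico_sum_dist f hij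
  have h₃ := dist_le_Ico_sum_dist f (Nat.le_of_lt_succ hj)
  simp only [Real.dist_eq] at h₁ h₂ h₃
  have hsplit : ∑ x ∈ range k, |f x - f (x + 1)| = ∑ x ∈ Ico 0 i, |f x - f (x + 1)| +
      ∑ x ∈ Ico i j, |f x - f (x + 1)| + ∑ x ∈ Ico j k, |f x - f (x + 1)| := by
    rw [sum_Ico_consecutive _ (Nat.zero_le i) hij,
      sum_Ico_consecutive _ (Nat.zero_le j) (Nat.le_of_lt_succ hj), range_eq_Ico]
  have h₄ : |f i - f j| ≤ |f 0 - f i| + |f k - f 0| + |f j - f k| := by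
    have h₅ := abs_sub_le (f i) (f 0) (f j)
    have h₆ := abs_sub_le (f 0) (f k) (f j)
    rw [abs_sub_comm (f i) (f 0)] at h₅
    rw [abs_sub_comm (f 0) (f k), abs_sub_comm (f k) (f j)] at h₆
    linarith
  rw [hD, hsplit]
  linarith

/-- The distance of `d` numbers from their mean is controlled by the cyclic total variation. -/
lemma sum_abs_sub_mean_le_cyclic_variation (f : ℕ → ℝ) {d : ℕ} {c : ℝ}
    (hc : ∑ x ∈ range d, f x = d * c) :
    ∑ x ∈ range d, |f x - c| ≤ d / 4 * ∑ x ∈ range d, |f x - f ((x + 1) % d)| := by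
  rcases Nat.eq_zero_or_pos d with rfl | hd
  · simp
  have hne : (range d).Nonempty := ⟨0, mem_range.2 hd⟩
  obtain ⟨i, hi, hmin⟩ := exists_min_image (range d) f hne
  obtain ⟨j, hj, hmax⟩ := exists_max_image (range d) f hne
  have h := sum_abs_sub_mean_le (range d) f (by rwa [card_range]) hmin hmax
  have hv := (le_abs_self _).trans
    (abs_sub_le_half_cyclic_variation f (mem_range.1 hj) (mem_range.1 hi))
  rw [card_range] at h
  have := mul_le_mul_of_nonneg_left hv (Nat.cast_nonneg (α := ℝ) d)
  linarith

lemma bijOn_succ_mod (d : ℕ) :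
    Set.BijOn (fun x => (x + 1) % d) (range d : Set ℕ) (range d : Set ℕ) := by
  have hmaps : Set.MapsTo (fun x => (x + 1) % d) (range d : Set ℕ) (range d : Set ℕ) := by
    intro x hx
    simp only [coe_range, Set.mem_Iio] at hx ⊢
    exact Nat.mod_lt _ (by omega)
  have hinj : Set.InjOn (fun x => (x + 1) % d) (range d : Set ℕ) := by
    intro x hx y hy hxy
    simp only [coe_range, Set.mem_Iio] at hx hy hxy
    have h : x + 1 ≡ y + 1 [MOD d] := hxy
    exact (Nat.ModEq.add_right_cancel' 1 h).eq_of_lt_of_lt hx hy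
  exact ⟨hmaps, hinj, surjOn_of_injOn_of_card_le _ hmaps hinj le_rfl⟩

lemma sum_range_comp {d : ℕ} {σ : ℕ → ℕ} (hσ : Set.BijOn σ (range d : Set ℕ) (range d : Set ℕ))
    (g : ℕ → ℝ) : ∑ x ∈ range d, g (σ x) = ∑ x ∈ range d, g x :=
  sum_nbij σ hσ.mapsTo hσ.injOn hσ.surjOn fun _ _ => rfl

/-- For a coupling `Q` of distributions `f` and `g` on `{0, …, d}` and a permutation `σ` of
`{0, …, d - 1}`, the probability of `y = σ x < d` bounds the distance of `f` and `g ∘ σ`. -/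
lemma sum_abs_sub_marginals_le {d : ℕ} {σ : ℕ → ℕ}
    (hσ : Set.BijOn σ (range d : Set ℕ) (range d : Set ℕ)) {Q : ℕ → ℕ → ℝ} {f g : ℕ → ℝ}
    (hQ : ∀ x y, 0 ≤ Q x y) (hf : ∀ x ∈ range (d + 1), ∑ y ∈ range (d + 1), Q x y = f x)
    (hg : ∀ y ∈ range (d + 1), ∑ x ∈ range (d + 1), Q x y = g y)
    (hf1 : ∑ x ∈ range (d + 1), f x = 1) (hg1 : ∑ y ∈ range (d + 1), g y = 1) :
    ∑ x ∈ range d, |f x - g (σ x)| + f d + g d ≤ 2 * (1 - ∑ x ∈ range d, Q x (σ x)) := by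
  rw [sum_range_succ] at hf1 hg1
  have key : ∀ x ∈ range d, |f x - g (σ x)| ≤ f x + g (σ x) - 2 * Q x (σ x) := by
    intro x hx
    have hx' : x ∈ range (d + 1) := range_subset_range.2 (Nat.le_succ d) hx
    have hσx : σ x ∈ range (d + 1) := range_subset_range.2 (Nat.le_succ d) (hσ.mapsTo hx)
    have h₁ : Q x (σ x) ≤ f x :=
      hf x hx' ▸ single_le_sum (f := fun y => Q x y) (fun y _ => hQ x y) hσx
    have h₂ : Q x (σ x) ≤ g (σ x) :=
      hg _ hσx ▸ single_le_sum (f := fun i => Q i (σ x)) (fun i _ => hQ i _) hx'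
    rw [abs_le]
    constructor <;> linarith
  have h := sum_le_sum key
  rw [sum_sub_distrib, sum_add_distrib, sum_range_comp hσ, ← mul_sum] at h
  linarith

lemma last_le_one_sub_sum {d : ℕ} {σ : ℕ → ℕ}
    (hσ : Set.BijOn σ (range d : Set ℕ) (range d : Set ℕ)) {Q : ℕ → ℕ → ℝ} {f : ℕ → ℝ}
    (hQ : ∀ x y, 0 ≤ Q x y) (hf : ∀ x ∈ range (d + 1), ∑ y ∈ range (d + 1), Q x y = f x)
    (hf1 : ∑ x ∈ range (d + 1), f x = 1) :
    f d ≤ 1 - ∑ x ∈ range d, Q x (σ x) := by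
  rw [sum_range_succ] at hf1
  have h : ∑ x ∈ range d, Q x (σ x) ≤ ∑ x ∈ range d, f x := by
    refine sum_le_sum fun x hx => ?_
    have hsub := range_subset_range.2 (Nat.le_succ d)
    rw [← hf x (hsub hx)]
    exact single_le_sum (f := fun y => Q x y) (fun y _ => hQ x y) (hsub (hσ.mapsTo hx))
  linarith

lemma sum_settings_adjacent (m : ℕ) (F : ℕ → ℕ → ℝ) :
    (∑ a ∈ settingsA (m + 1), ∑ b ∈ settingsB (m + 1),
      if a + 1 = b ∨ b + 1 = a then F a b else 0) =
    ∑ i ∈ range (m + 1), F (2 * i) (2 * i + 1) + ∑ i ∈ range m, F (2 * (i + 1)) (2 * i + 1) := by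
  have hA : Function.Injective fun i : ℕ => 2 * i := fun i j h => by simpa using h
  have hB : Function.Injective fun i : ℕ => 2 * i + 1 := fun i j h => by simpa using h
  rw [settingsA, settingsB, sum_image hA.injOn]
  simp only [sum_image hB.injOn]
  have hsplit : ∀ i j : ℕ,
      (if 2 * i + 1 = 2 * j + 1 ∨ 2 * j + 1 + 1 = 2 * i then F (2 * i) (2 * j + 1) else 0) =
      (if i = j then F (2 * i) (2 * j + 1) else 0) +
        if i = j + 1 then F (2 * i) (2 * j + 1) else 0 := by
    intro i j
    split_ifs <;> first | omega | simp
  simp only [hsplit, sum_add_distrib]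
  congr 1
  · refine sum_congr rfl fun i hi => ?_
    rw [sum_ite_eq, if_pos hi]
  · rw [sum_comm, sum_range_succ]
    simp only [sum_ite_eq', mem_range]
    rw [if_neg (lt_irrefl _), add_zero]
    refine sum_congr rfl fun i hi => ?_
    rw [if_pos (by have := mem_range.1 hi; omega)]

/-- The chained-Bell expression as a sum of failure probabilities along the chain. -/
lemma chainedBell_succ (m d : ℕ) (P : ℕ → ℕ → ℕ → ℕ → ℝ) :
    chainedBell (m + 1) d P = (1 - ∑ x ∈ range d, P 0 (2 * m + 1) x ((x + 1) % d)) +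
      ∑ i ∈ range (m + 1), (1 - ∑ x ∈ range d, P (2 * i) (2 * i + 1) x x) +
      ∑ i ∈ range m, (1 - ∑ x ∈ range d, P (2 * (i + 1)) (2 * i + 1) x x) := by
  rw [chainedBell, sum_settings_adjacent m fun a b => ∑ x ∈ range d, P a b x x,
    show 2 * (m + 1) - 1 = 2 * m + 1 by omega, sum_sub_distrib, sum_sub_distrib]
  simp only [sum_const, card_range, nsmul_eq_mul]
  push_cast
  ring

/-- If consecutive members of the zigzag `p 0, q 1, p 2, q 3, …` are close, so are its ends. -/
lemma sum_abs_sub_zigzag_le {d : ℕ} {p q : ℕ → ℕ → ℝ} {E : ℕ → ℕ → ℝ} (m : ℕ)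
    (hp : ∀ i ≤ m, 0 ≤ p (2 * i) d) (hq : ∀ i ≤ m, 0 ≤ q (2 * i + 1) d)
    (h₁ : ∀ i ≤ m, ∑ x ∈ range d, |p (2 * i) x - q (2 * i + 1) x| + p (2 * i) d +
      q (2 * i + 1) d ≤ 2 * E (2 * i) (2 * i + 1))
    (h₂ : ∀ i < m, ∑ x ∈ range d, |p (2 * (i + 1)) x - q (2 * i + 1) x| + p (2 * (i + 1)) d +
      q (2 * i + 1) d ≤ 2 * E (2 * (i + 1)) (2 * i + 1)) :
    ∑ x ∈ range d, |p 0 x - q (2 * m + 1) x| + p 0 d ≤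
      2 * (∑ i ∈ range (m + 1), E (2 * i) (2 * i + 1) +
        ∑ i ∈ range m, E (2 * (i + 1)) (2 * i + 1)) := by
  induction m with
  | zero =>
    have := h₁ 0 le_rfl
    have := hq 0 le_rfl
    simp only [mul_zero, zero_add, range_one, sum_singleton, range_zero, sum_empty,
      add_zero] at *
    linarith
  | succ m ih =>
    have ih := ih (fun i hi => hp i (by omega)) (fun i hi => hq i (by omega))
      (fun i hi => h₁ i (by omega)) (fun i hi => h₂ i (by omega))
    have htri : ∑ x ∈ range d, |p 0 x - q (2 * (m + 1) + 1) x| ≤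
        ∑ x ∈ range d, |p 0 x - q (2 * m + 1) x| +
        ∑ x ∈ range d, |p (2 * (m + 1)) x - q (2 * m + 1) x| +
        ∑ x ∈ range d, |p (2 * (m + 1)) x - q (2 * (m + 1) + 1) x| := by
      rw [← sum_add_distrib, ← sum_add_distrib]
      refine sum_le_sum fun x _ => ?_
      have h₃ := abs_sub_le (p 0 x) (q (2 * m + 1) x) (q (2 * (m + 1) + 1) x)
      have h₄ := abs_sub_le (q (2 * m + 1) x) (p (2 * (m + 1)) x) (q (2 * (m + 1) + 1) x)
      rw [abs_sub_comm (q (2 * m + 1) x) (p (2 * (m + 1)) x)] at h₄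
      linarith
    have e₁ := h₁ (m + 1) le_rfl
    have e₂ := h₂ m (Nat.lt_succ_self m)
    have n₁ := hp (m + 1) le_rfl
    have n₂ := hq (m + 1) le_rfl
    have n₃ := hq m (Nat.le_succ m)
    rw [sum_range_succ _ (m + 1), sum_range_succ _ m]
    rw [sum_range_succ] at ih ⊢
    linarith

lemma two_mul_mem_settingsA {n i : ℕ} (h : i < n) : 2 * i ∈ settingsA n :=
  mem_image_of_mem _ (mem_range.2 h)

lemma two_mul_add_one_mem_settingsB {n i : ℕ} (h : i < n) : 2 * i + 1 ∈ settingsB n :=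
  mem_image_of_mem (fun i => 2 * i + 1) (mem_range.2 h)

/-- The bound for a single no-signalling family. -/
lemma chainedBell_bounds_dist_to_uniform {n d : ℕ} (hn : 1 ≤ n) (hd : 1 ≤ d)
    {P : ℕ → ℕ → ℕ → ℕ → ℝ}
    (hpos : ∀ a ∈ settingsA n, ∀ b ∈ settingsB n, ∀ x y : ℕ, 0 ≤ P a b x y)
    (hnorm : ∀ a ∈ settingsA n, ∀ b ∈ settingsB n,
      ∑ x ∈ range (d + 1), ∑ y ∈ range (d + 1), P a b x y = 1)
    (hnsA : ∀ a ∈ settingsA n, ∀ b ∈ settingsB n, ∀ b' ∈ settingsB n, ∀ x ∈ range (d + 1),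
      ∑ y ∈ range (d + 1), P a b x y = ∑ y ∈ range (d + 1), P a b' x y)
    (hnsB : ∀ a ∈ settingsA n, ∀ a' ∈ settingsA n, ∀ b ∈ settingsB n, ∀ y ∈ range (d + 1),
      ∑ x ∈ range (d + 1), P a b x y = ∑ x ∈ range (d + 1), P a' b x y) :
    ∑ x ∈ range d, |(∑ y ∈ range (d + 1), P 0 1 x y) - 1 / d| ≤
      ((d : ℝ) / 2) * chainedBell n d P := by
  obtain ⟨m, rfl⟩ : ∃ m, n = m + 1 := ⟨n - 1, by omega⟩
  have hA {i : ℕ} (hi : i ≤ m) := two_mul_mem_settingsA (Nat.lt_succ_of_le hi)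
  have hB {i : ℕ} (hi : i ≤ m) := two_mul_add_one_mem_settingsB (Nat.lt_succ_of_le hi)
  have hA0 : 0 ∈ settingsA (m + 1) := hA (Nat.zero_le m)
  have hB1 : 1 ∈ settingsB (m + 1) := hB (Nat.zero_le m)
  set p : ℕ → ℕ → ℝ := fun a x => ∑ y ∈ range (d + 1), P a 1 x y
  set q : ℕ → ℕ → ℝ := fun b y => ∑ x ∈ range (d + 1), P 0 b x y
  have hp1 {a : ℕ} (ha : a ∈ settingsA (m + 1)) : ∑ x ∈ range (d + 1), p a x = 1 :=
    hnorm a ha 1 hB1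
  have hq1 {b : ℕ} (hb : b ∈ settingsB (m + 1)) : ∑ y ∈ range (d + 1), q b y = 1 := by
    rw [← hnorm 0 hA0 b hb, sum_comm]
  have hp0 {a : ℕ} (ha : a ∈ settingsA (m + 1)) : 0 ≤ p a d :=
    sum_nonneg fun y _ => hpos a ha 1 hB1 d y
  have hq0 {b : ℕ} (hb : b ∈ settingsB (m + 1)) : 0 ≤ q b d :=
    sum_nonneg fun x _ => hpos 0 hA0 b hb x d
  have hedge {a b : ℕ} (ha : a ∈ settingsA (m + 1)) (hb : b ∈ settingsB (m + 1)) {σ : ℕ → ℕ}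
      (hσ : Set.BijOn σ (range d : Set ℕ) (range d : Set ℕ)) :
      ∑ x ∈ range d, |p a x - q b (σ x)| + p a d + q b d ≤
        2 * (1 - ∑ x ∈ range d, P a b x (σ x)) :=
    sum_abs_sub_marginals_le hσ (hpos a ha b hb) (hnsA a ha b hb 1 hB1)
      (hnsB a ha 0 hA0 b hb) (hp1 ha) (hq1 hb)
  have hzig := sum_abs_sub_zigzag_le (d := d) (p := p) (q := q)
    (E := fun a b => 1 - ∑ x ∈ range d, P a b x x) m
    (fun i hi => hp0 (hA hi)) (fun i hi => hq0 (hB hi))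
    (fun i hi => hedge (hA hi) (hB hi) (Set.bijOn_id _))
    (fun i hi => hedge (hA (Nat.succ_le_of_lt hi)) (hB hi.le) (Set.bijOn_id _))
  have hlast := hedge hA0 (hB le_rfl) (bijOn_succ_mod d)
  have hqlast := hq0 (hB le_rfl)
  have hδ := hp0 hA0
  have hvar : ∑ x ∈ range d, |p 0 x - p 0 ((x + 1) % d)| ≤
      ∑ x ∈ range d, |p 0 x - q (2 * m + 1) ((x + 1) % d)| +
        ∑ x ∈ range d, |p 0 x - q (2 * m + 1) x| := by
    rw [← sum_range_comp (bijOn_succ_mod d) fun x => |p 0 x - q (2 * m + 1) x|,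
      ← sum_add_distrib]
    refine sum_le_sum fun x _ => ?_
    rw [abs_sub_comm (p 0 ((x + 1) % d))]
    exact abs_sub_le _ _ _
  have hI := chainedBell_succ m d P
  have hsum : ∑ x ∈ range d, p 0 x = 1 - p 0 d := by
    rw [← hp1 hA0, sum_range_succ, add_sub_cancel_right]
  rcases hd.eq_or_lt with rfl | hd2
  · have h₁ := last_le_one_sub_sum (bijOn_succ_mod 1) (hpos 0 hA0 _ (hB le_rfl))
      (hnsA 0 hA0 _ (hB le_rfl) 1 hB1) (hp1 hA0)
    have h₂ : p 0 1 ≤ ∑ i ∈ range (m + 1), (1 - ∑ x ∈ range 1, P (2 * i) (2 * i + 1) x x) := by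
      refine (last_le_one_sub_sum (Set.bijOn_id _) (hpos 0 hA0 1 hB1) (fun _ _ => rfl)
        (hp1 hA0)).trans (single_le_sum
        (f := fun i => 1 - ∑ x ∈ range 1, P (2 * i) (2 * i + 1) x x) (fun i hi => ?_)
        (mem_range.2 m.succ_pos))
      have hi : i ≤ m := Nat.le_of_lt_succ (mem_range.1 hi)
      have h := hedge (hA hi) (hB hi) (Set.bijOn_id _)
      have h₃ := hp0 (hA hi)
      have h₄ := hq0 (hB hi)
      have h₅ : 0 ≤ ∑ x ∈ range 1, |p (2 * i) x - q (2 * i + 1) (id x)| :=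
        sum_nonneg fun _ _ => abs_nonneg _
      simp only [id] at h h₅
      linarith
    have h₃ : 0 ≤ ∑ i ∈ range m, (1 - ∑ x ∈ range 1, P (2 * (i + 1)) (2 * i + 1) x x) := by
      refine sum_nonneg fun i hi => ?_
      have hi := mem_range.1 hi
      have h := hedge (hA (Nat.succ_le_of_lt hi)) (hB hi.le) (Set.bijOn_id _)
      have h₃ := hp0 (hA (Nat.succ_le_of_lt hi))
      have h₄ := hq0 (hB hi.le)
      have h₅ : 0 ≤ ∑ x ∈ range 1, |p (2 * (i + 1)) x - q (2 * i + 1) (id x)| :=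
        sum_nonneg fun _ _ => abs_nonneg _
      simp only [id] at h h₅
      linarith
    rw [sum_range_one] at hsum
    change ∑ x ∈ range 1, |p 0 x - 1 / (1 : ℕ)| ≤ _
    rw [sum_range_one, hsum, Nat.cast_one, div_one, abs_of_nonpos (by linarith)]
    linarith
  · have hd0 : (2 : ℝ) ≤ d := by exact_mod_cast hd2
    have hmean := sum_abs_sub_mean_le_cyclic_variation (p 0) (d := d) (c := (1 - p 0 d) / d)
      (by rw [hsum]; field_simp)
    have hshift : ∑ x ∈ range d, |p 0 x - 1 / d| ≤
        ∑ x ∈ range d, |p 0 x - (1 - p 0 d) / d| + p 0 d := by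
      have hconst : ∑ x ∈ range d, p 0 d / d = p 0 d := by
        rw [sum_const, card_range, nsmul_eq_mul]
        field_simp
      refine (sum_le_sum fun x _ => ?_).trans_eq
        (sum_add_distrib.trans (congrArg (_ + ·) hconst))
      have h := abs_sub_le (p 0 x) ((1 - p 0 d) / d) (1 / d)
      have hdiff : (1 - p 0 d) / d - 1 / d = -(p 0 d / d) := by ring
      rwa [hdiff, abs_neg, abs_of_nonneg (div_nonneg hδ (by linarith))] at h
    have htotal : ∑ x ∈ range d, |p 0 x - p 0 ((x + 1) % d)| + 2 * p 0 d ≤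
        2 * chainedBell (m + 1) d P := by
      rw [hI]
      linarith
    have h₁ := mul_le_mul_of_nonneg_left htotal (by positivity : (0 : ℝ) ≤ d / 4)
    have h₂ := mul_le_mul_of_nonneg_right hd0 hδ
    change ∑ x ∈ range d, |p 0 x - 1 / d| ≤ _
    linarith

/-- The chained-Bell expression of a mixture is the mixture of the chained-Bell expressions. -/
lemma hasSum_mul_chainedBell {n d : ℕ} (hn : 1 ≤ n) {L : Type*} {w : L → ℝ} (hw : HasSum w 1)
    {P : L → ℕ → ℕ → ℕ → ℕ → ℝ}
    (hP : ∀ a ∈ settingsA n, ∀ b ∈ settingsB n, ∀ x ∈ range d, ∀ y ∈ range d,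
      Summable fun l => w l * P l a b x y) :
    HasSum (fun l => w l * chainedBell n d (P l))
      (chainedBell n d fun a b x y => ∑' l, w l * P l a b x y) := by
  obtain ⟨m, rfl⟩ : ∃ m, n = m + 1 := ⟨n - 1, by omega⟩
  have hA {i : ℕ} (hi : i ≤ m) := two_mul_mem_settingsA (Nat.lt_succ_of_le hi)
  have hB {i : ℕ} (hi : i ≤ m) := two_mul_add_one_mem_settingsB (Nat.lt_succ_of_le hi)
  have hedge {a b : ℕ} (ha : a ∈ settingsA (m + 1)) (hb : b ∈ settingsB (m + 1)) {σ : ℕ → ℕ}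
      (hσ : Set.BijOn σ (range d : Set ℕ) (range d : Set ℕ)) :
      HasSum (fun l => w l * (1 - ∑ x ∈ range d, P l a b x (σ x)))
        (1 - ∑ x ∈ range d, ∑' l, w l * P l a b x (σ x)) := by
    simp only [mul_sub, mul_one, mul_sum]
    exact hw.sub (hasSum_sum fun x hx => (hP a ha b hb x hx _ (hσ.mapsTo hx)).hasSum)
  simp only [chainedBell_succ, mul_add, mul_sum]
  refine ((hedge (hA (Nat.zero_le m)) (hB le_rfl) (bijOn_succ_mod d)).add
    (hasSum_sum fun i hi => ?_)).add (hasSum_sum fun i hi => ?_)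
  · have hi : i ≤ m := Nat.le_of_lt_succ (mem_range.1 hi)
    exact hedge (hA hi) (hB hi) (Set.bijOn_id _)
  · have hi := mem_range.1 hi
    exact hedge (hA (Nat.succ_le_of_lt hi)) (hB hi.le) (Set.bijOn_id _)

/-- **Lemma 2 of the paper.**
Let `w` be a probability distribution on a countable type `L` (the distribution
of the hidden variable `Λ`), and for each `l ∈ L` let `P l a b` (for
`a ∈ 𝒜_n`, `b ∈ ℬ_n`) be a no-signalling family of probability distributions on
pairs of outcomes in `{0,…,d} × {0,…,d}`.  Then, with
`P̄(x,y|a,b) = Σ_l w(l)·P_l(x,y|a,b)` the averaged distribution,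
`Σ_l w(l) · Σ_{x=0}^{d−1} |P_l(x|a=0) − 1/d| ≤ (d/2)·I_{n,d}(P̄)`. -/
theorem averaged_chainedBell_bounds_dist_to_uniform (n d : ℕ) (hn : 1 ≤ n) (hd : 1 ≤ d)
    {L : Type*} [Countable L]
    (w : L → ℝ) (hw0 : ∀ l, 0 ≤ w l) (hw1 : ∑' l, w l = 1)
    (P : L → ℕ → ℕ → ℕ → ℕ → ℝ)
    (hpos : ∀ l, ∀ a ∈ settingsA n, ∀ b ∈ settingsB n, ∀ x y : ℕ, 0 ≤ P l a b x y)
    (hnorm : ∀ l, ∀ a ∈ settingsA n, ∀ b ∈ settingsB n,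
      ∑ x ∈ Finset.range (d + 1), ∑ y ∈ Finset.range (d + 1), P l a b x y = 1)
    (hnsA : ∀ l, ∀ a ∈ settingsA n, ∀ b ∈ settingsB n, ∀ b' ∈ settingsB n,
      ∀ x ∈ Finset.range (d + 1),
        ∑ y ∈ Finset.range (d + 1), P l a b x y =
          ∑ y ∈ Finset.range (d + 1), P l a b' x y)
    (hnsB : ∀ l, ∀ a ∈ settingsA n, ∀ a' ∈ settingsA n, ∀ b ∈ settingsB n,
      ∀ y ∈ Finset.range (d + 1),
        ∑ x ∈ Finset.range (d + 1), P l a b x y =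
          ∑ x ∈ Finset.range (d + 1), P l a' b x y) :
    ∑' l, w l * ∑ x ∈ Finset.range d,
        |(∑ y ∈ Finset.range (d + 1), P l 0 1 x y) - 1 / d| ≤
      ((d : ℝ) / 2) * chainedBell n d (fun a b x y => ∑' l, w l * P l a b x y) := by
  have hw : HasSum w 1 := by
    have hs : Summable w := by
      by_contra h
      rw [tsum_eq_zero_of_not_summable h] at hw1
      exact zero_ne_one hw1
    exact hw1 ▸ hs.hasSum
  have hle : ∀ l, ∀ a ∈ settingsA n, ∀ b ∈ settingsB n, ∀ x ∈ range d, ∀ y ∈ range d,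
      P l a b x y ≤ 1 := by
    intro l a ha b hb x hx y hy
    have hsub := range_subset_range.2 (Nat.le_succ d)
    rw [← hnorm l a ha b hb]
    exact (single_le_sum (f := fun y => P l a b x y) (fun y _ => hpos l a ha b hb x y)
      (hsub hy)).trans (single_le_sum (f := fun x => ∑ y ∈ range (d + 1), P l a b x y)
      (fun x _ => sum_nonneg fun y _ => hpos l a ha b hb x y) (hsub hx))
  have hsum := hasSum_mul_chainedBell (d := d) hn hw fun a ha b hb x hx y hy =>
    hw.summable.of_nonneg_of_le (fun l => mul_nonneg (hw0 l) (hpos l a ha b hb x y))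
      fun l => mul_le_of_le_one_right (hw0 l) (hle l a ha b hb x hx y hy)
  have hbound := fun l => mul_le_mul_of_nonneg_left
    (chainedBell_bounds_dist_to_uniform hn hd (hpos l) (hnorm l) (hnsA l) (hnsB l)) (hw0 l)
  have hsum' := hsum.mul_left ((d : ℝ) / 2)
  simp only [mul_left_comm _ (w _)] at hsum'
  rw [← hsum'.tsum_eq]
  refine Summable.tsum_le_tsum hbound ?_ hsum'.summable
  exact hsum'.summable.of_nonneg_of_le
    (fun l => mul_nonneg (hw0 l) (sum_nonneg fun _ _ => abs_nonneg _)) hbound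
end

section
/- For all integers n ≥ 1 and d ≥ 1, one has 2n · (1 − sin²(π/(2n)) / (d² · sin²(π/(2dn)))) ≤ π²/(6n). -/
theorem sq_sub_pow_four_div_three_le_sin_sq {x : ℝ} (hx : 0 < x) (hx2 : x ≤ 2) :
    x ^ 2 - x ^ 4 / 3 ≤ Real.sin x ^ 2 := by
  have h := (Real.sin_gt_sub_cube hx).le
  have h0 : 0 ≤ x - x ^ 3 / 6 := by
    have : 0 ≤ x * (6 - x ^ 2) := mul_nonneg hx.le (by nlinarith)
    linarith
  calc x ^ 2 - x ^ 4 / 3 ≤ (x - x ^ 3 / 6) ^ 2 := by nlinarith [sq_nonneg (x ^ 3)]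
    _ ≤ Real.sin x ^ 2 := pow_le_pow_left₀ h0 h 2

/-- **Analytic bound underlying Eq. (5) of the paper.**
For all integers `n ≥ 1` and `d ≥ 1`,
`2n · (1 − sin²(π/(2n)) / (d² · sin²(π/(2dn)))) ≤ π²/(6n)`. -/
theorem chained_bell_analytic_bound (n d : ℕ) (hn : 1 ≤ n) (hd : 1 ≤ d) :
    2 * (n : ℝ) *
      (1 - Real.sin (Real.pi / (2 * n)) ^ 2 /
        ((d : ℝ) ^ 2 * Real.sin (Real.pi / (2 * d * n)) ^ 2)) ≤
    Real.pi ^ 2 / (6 * n) := by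
  have hn' : (1 : ℝ) ≤ n := by exact_mod_cast hn
  have hd' : (1 : ℝ) ≤ d := by exact_mod_cast hd
  have hn0 : (0 : ℝ) < n := by linarith
  have hd0 : (0 : ℝ) < d := by linarith
  have hpi := Real.pi_pos
  set x := Real.pi / (2 * (n : ℝ)) with hx
  set y := Real.pi / (2 * (d : ℝ) * n) with hy
  have hx0 : 0 < x := by positivity
  have hy0 : 0 < y := by positivity
  have hx2 : x ≤ 2 := by
    rw [hx, div_le_iff₀ (by positivity)]
    linarith [Real.pi_le_four]
  have hdy : d * y = x := by rw [hx, hy]; field_simp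
  have hyx : y ≤ x := by nlinarith
  have hsy : 0 < Real.sin y :=
    Real.sin_pos_of_pos_of_lt_pi hy0 (by linarith [Real.pi_gt_three])
  have hden : (d : ℝ) ^ 2 * Real.sin y ^ 2 ≤ x ^ 2 := by
    rw [← hdy, mul_pow]
    gcongr
    exact Real.sin_le hy0.le
  have hratio : 1 - x ^ 2 / 3 ≤ Real.sin x ^ 2 / ((d : ℝ) ^ 2 * Real.sin y ^ 2) :=
    calc 1 - x ^ 2 / 3 ≤ Real.sin x ^ 2 / x ^ 2 := by
          rw [le_div_iff₀ (by positivity)]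
          linarith [sq_sub_pow_four_div_three_le_sin_sq hx0 hx2]
      _ ≤ Real.sin x ^ 2 / ((d : ℝ) ^ 2 * Real.sin y ^ 2) := by gcongr
  calc 2 * (n : ℝ) * (1 - Real.sin x ^ 2 / ((d : ℝ) ^ 2 * Real.sin y ^ 2))
      ≤ 2 * n * (x ^ 2 / 3) := by
        gcongr
        linarith
    _ = Real.pi ^ 2 / (6 * n) := by
        rw [hx]
        field_simp
        norm_num
end

section
/- Let d ≥ 1 and let P be a probability distribution on ℤ/dℤ. Let P' denote the pushforward of P under the shift x ↦ x + 1, i.e., P'(x) = P(x − 1). Then D(P, u_d) ≤ (1/d) · ⌊d²/4⌋ · D(P', P), where u_d is the uniform distribution on ℤ/dℤ. -/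
theorem ZMod.sum_range_natCast {M : Type*} [AddCommMonoid M] (d : ℕ) [NeZero d] (g : ZMod d → M) :
    ∑ i ∈ Finset.range d, g (i : ZMod d) = ∑ z, g z := by
  refine Finset.sum_nbij' (fun i : ℕ => (i : ZMod d)) ZMod.val ?_ ?_ ?_ ?_ ?_
  · simp
  · intro z _
    simpa using ZMod.val_lt z
  · intro i hi
    exact ZMod.val_cast_of_lt (Finset.mem_range.1 hi)
  · intro z _
    exact ZMod.natCast_zmod_val z
  · simp

/-- On a cycle, the oscillation of a function is at most half of its cyclic variation. -/
theorem ZMod.two_mul_dist_le_sum_dist_shift {E : Type*} [PseudoMetricSpace E] (d : ℕ) [NeZero d]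
    (f : ZMod d → E) (x y : ZMod d) :
    2 * dist (f x) (f y) ≤ ∑ z, dist (f (z - 1)) (f z) := by
  set Q : ℕ → E := fun i => f (x + i) with hQ
  have hn : (y - x).val ≤ d := (ZMod.val_lt _).le
  have h0 : Q 0 = f x := by simp [hQ]
  have hy : Q (y - x).val = f y := by simp [hQ]
  have hd : Q d = f x := by simp [hQ]
  have h1 := dist_le_range_sum_dist Q (y - x).val
  have h2 := dist_le_Ico_sum_dist Q hn
  have h3 := Finset.sum_range_add_sum_Ico (fun i => dist (Q i) (Q (i + 1))) hn
  have h4 : ∑ i ∈ Finset.range d, dist (Q i) (Q (i + 1)) = ∑ z, dist (f (z - 1)) (f z) := by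
    rw [← Equiv.sum_comp (Equiv.addLeft (x + 1)), ← ZMod.sum_range_natCast]
    refine Finset.sum_congr rfl fun i _ => ?_
    simp only [hQ, Equiv.coe_addLeft]
    congr 2 <;> push_cast <;> ring
  rw [h0, hy] at h1
  rw [hy, hd, dist_comm] at h2
  linarith

/-- The `ℓ¹` norm of a zero-sum function is controlled by its oscillation. -/
theorem card_mul_sum_abs_le_of_sum_eq_zero {ι : Type*} [Fintype ι] (f : ι → ℝ) (V : ℝ)
    (hf : ∑ x, f x = 0) (hV0 : 0 ≤ V) (hV : ∀ x y, 2 * (f x - f y) ≤ V) :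
    Fintype.card ι * ∑ x, |f x| ≤ ((Fintype.card ι ^ 2 / 4 : ℕ) : ℝ) * V := by
  classical
  set S := Finset.univ.filter fun x => 0 ≤ f x with hS
  have hsum : ∑ x ∈ S, f x + ∑ x ∈ Sᶜ, f x = 0 := by rw [Finset.sum_add_sum_compl, hf]
  have habs : ∑ x, |f x| = ∑ x ∈ S, f x - ∑ x ∈ Sᶜ, f x := by
    rw [← Finset.sum_add_sum_compl S, sub_eq_add_neg, ← Finset.sum_neg_distrib]
    congr 1
    · exact Finset.sum_congr rfl fun x hx => abs_of_nonneg (by simpa [hS] using hx)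
    · refine Finset.sum_congr rfl fun x hx => abs_of_neg (by simpa [hS] using hx)
  have hcard : S.card + Sᶜ.card = Fintype.card ι := Finset.card_add_card_compl S
  have hprod : S.card * Sᶜ.card ≤ Fintype.card ι ^ 2 / 4 := by
    rw [Nat.le_div_iff_mul_le (by norm_num), ← hcard]
    nlinarith [four_mul_le_sq_add S.card Sᶜ.card]
  have hle : ∑ x ∈ S, ∑ y ∈ Sᶜ, 2 * (f x - f y) ≤ ∑ _x ∈ S, ∑ _y ∈ Sᶜ, V :=
    Finset.sum_le_sum fun x _ => Finset.sum_le_sum fun y _ => hV x y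
  simp only [← Finset.mul_sum, Finset.sum_sub_distrib, Finset.sum_const, nsmul_eq_mul] at hle
  calc (Fintype.card ι : ℝ) * ∑ x, |f x|
      = 2 * (Sᶜ.card * ∑ x ∈ S, f x - S.card * ∑ y ∈ Sᶜ, f y) := by
        rw [habs, ← hcard, eq_neg_of_add_eq_zero_right hsum]
        push_cast
        ring
    _ ≤ ((S.card * Sᶜ.card : ℕ) : ℝ) * V := by
        push_cast
        linarith
    _ ≤ _ := mul_le_mul_of_nonneg_right (by exact_mod_cast hprod) hV0

/-- **Lemma 5 of the paper.**
Let `P` be a probability distribution on `ℤ/dℤ` (`d ≥ 1`) and let `P'` be its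
pushforward under the shift `x ↦ x + 1`, i.e. `P'(x) = P(x − 1)`.  Then
`D(P, u_d) ≤ (1/d) · ⌊d²/4⌋ · D(P', P)`, where `u_d` is the uniform distribution
and `D` is the total variation distance `D(P,Q) = (1/2) Σ_x |P(x) − Q(x)|`. -/
theorem tv_dist_to_uniform_le_shift (d : ℕ) [NeZero d]
    (P : ZMod d → ℝ) (hP0 : ∀ x, 0 ≤ P x) (hP1 : ∑ x, P x = 1) :
    (1 / 2) * ∑ x, |P x - 1 / d| ≤
      (1 / d) * ((d ^ 2 / 4 : ℕ) : ℝ) * ((1 / 2) * ∑ x, |P (x - 1) - P x|) := by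
  have hd : (0 : ℝ) < d := by exact_mod_cast NeZero.pos d
  have hsum : ∑ x, (P x - 1 / d) = 0 := by
    simp [Finset.sum_sub_distrib, hP1, ZMod.card, hd.ne']
  have key := card_mul_sum_abs_le_of_sum_eq_zero (fun x => P x - 1 / d)
    (∑ x, |P (x - 1) - P x|) hsum (Finset.sum_nonneg fun _ _ => abs_nonneg _) fun x y => by
      have h := ZMod.two_mul_dist_le_sum_dist_shift d P x y
      simp only [Real.dist_eq] at h
      linarith [le_abs_self (P x - P y)]
  rw [ZMod.card, mul_comm, ← le_div_iff₀ hd] at key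
  calc (1 / 2) * ∑ x, |P x - 1 / d|
      ≤ (1 / 2) * (((d ^ 2 / 4 : ℕ) : ℝ) * (∑ x, |P (x - 1) - P x|) / d) := by gcongr
    _ = _ := by ring
end

section
/- Fix integers n, d ≥ 1 and k ∈ {0,1,...,2n−1}. The vectors ζ_0^k, ζ_1^k, ..., ζ_{d−1}^k form an orthonormal family in ℂ^d: ⟨ζ_j^k, ζ_{j'}^k⟩ = 1 if j = j' and 0 otherwise. In particular, they form an orthonormal basis of ℂ^d. -/
/-- The vector `ζ_j^k = (X̂_d)^{k/(2n)} |j⟩ ∈ ℂ^d` of the paper (Appendix B),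
given componentwise by
`ζ_j^k(m) = (1/d)·(1 − exp(iπk/n)) / (1 − exp((2πi/d)(m + k/(2n) − j)))`
for `k ≠ 0`, and `ζ_j^0 = e_j` (the `j`-th standard basis vector). -/
noncomputable def zeta (n d j k m : ℕ) : ℂ :=
  if k = 0 then (if m = j then 1 else 0)
  else (1 / (d : ℂ)) * (1 - Complex.exp (Complex.I * Real.pi * k / n)) /
    (1 - Complex.exp (2 * Real.pi * Complex.I / d * ((m : ℂ) + (k : ℂ) / (2 * n) - (j : ℂ))))

/-- Orthogonality of the additive characters of `ℤ/dℤ`. -/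
lemma sum_range_exp_sub_mul (d a b : ℕ) (ha : a < d) (hb : b < d) :
    ∑ l ∈ Finset.range d,
        Complex.exp (2 * Real.pi * Complex.I / d * (((a : ℂ) - (b : ℂ)) * (l : ℂ))) =
      if a = b then (d : ℂ) else 0 := by
  split_ifs with hab
  · simp [hab]
  have hd : d ≠ 0 := by omega
  have hd' : (d : ℂ) ≠ 0 := Nat.cast_ne_zero.mpr hd
  set x := Complex.exp (2 * Real.pi * Complex.I / d * ((a : ℂ) - (b : ℂ))) with hx
  have hpow : ∀ l : ℕ,
      Complex.exp (2 * Real.pi * Complex.I / d * (((a : ℂ) - (b : ℂ)) * (l : ℂ))) = x ^ l := by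
    intro l
    rw [hx, ← Complex.exp_nat_mul]
    congr 1
    ring
  have hxd : x ^ d = 1 := by
    rw [← hpow, Complex.exp_eq_one_iff]
    refine ⟨(a : ℤ) - b, ?_⟩
    push_cast
    field_simp
  have hx1 : x ≠ 1 := by
    intro h
    obtain ⟨r, hr⟩ := Complex.exp_eq_one_iff.mp h
    have hr' : ((a : ℂ) - b) = r * d := by
      have := Complex.two_pi_I_ne_zero
      field_simp at hr
      linear_combination hr
    have hr'' : (a : ℤ) - b = r * d := by exact_mod_cast hr'
    have habs : |(a : ℤ) - b| < d := by rw [abs_lt]; omega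
    have := Int.eq_zero_of_abs_lt_dvd (Dvd.intro_left r hr''.symm) habs
    omega
  simp_rw [hpow]
  rw [geom_sum_eq hx1, hxd]
  simp

lemma exp_I_pi_mul_div_ne_one {n k : ℕ} (hk0 : k ≠ 0) (hk : k < 2 * n) :
    Complex.exp (Complex.I * Real.pi * k / n) ≠ 1 := by
  intro h
  obtain ⟨r, hr⟩ := Complex.exp_eq_one_iff.mp h
  have hn : (n : ℂ) ≠ 0 := Nat.cast_ne_zero.mpr (by omega)
  have hr' : (k : ℂ) = r * (2 * n) := by
    have hpi : (Real.pi : ℂ) ≠ 0 := Complex.ofReal_ne_zero.mpr Real.pi_ne_zero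
    have hI := Complex.I_ne_zero
    field_simp at hr
    linear_combination hr
  have hr'' : (k : ℤ) = r * ((2 * n : ℕ) : ℤ) := by exact_mod_cast hr'
  have habs : |(k : ℤ)| < (2 * n : ℕ) := by rw [abs_lt]; omega
  have := Int.eq_zero_of_abs_lt_dvd (Dvd.intro_left r hr''.symm) habs
  omega

/-- Fourier expansion of `ζ_j^k`, valid also for `k = 0`. -/
lemma zeta_eq_sum_exp {n d j k m : ℕ} (hk : k < 2 * n) (hj : j < d) (hm : m < d) :
    zeta n d j k m = 1 / (d : ℂ) * ∑ l ∈ Finset.range d,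
      Complex.exp (2 * Real.pi * Complex.I / d *
        (((m : ℂ) + (k : ℂ) / (2 * n) - (j : ℂ)) * (l : ℂ))) := by
  have hd : (d : ℂ) ≠ 0 := Nat.cast_ne_zero.mpr (by omega)
  have hn : (n : ℂ) ≠ 0 := Nat.cast_ne_zero.mpr (by omega)
  unfold zeta
  split_ifs with hk0 hmj
  · have := sum_range_exp_sub_mul d m j hm hj
    simp_all
  · have := sum_range_exp_sub_mul d m j hm hj
    simp_all
  · set x := Complex.exp (2 * Real.pi * Complex.I / d *
      ((m : ℂ) + (k : ℂ) / (2 * n) - (j : ℂ))) with hx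
    have hpow : ∀ l : ℕ, Complex.exp (2 * Real.pi * Complex.I / d *
        (((m : ℂ) + (k : ℂ) / (2 * n) - (j : ℂ)) * (l : ℂ))) = x ^ l := by
      intro l
      rw [hx, ← Complex.exp_nat_mul]
      congr 1
      ring
    have hxd : x ^ d = Complex.exp (Complex.I * Real.pi * k / n) := by
      rw [← hpow, Complex.exp_eq_exp_iff_exists_int]
      refine ⟨(m : ℤ) - j, ?_⟩
      push_cast
      field_simp
      ring
    have hx1 : 1 - x ≠ 0 := by
      intro h
      apply exp_I_pi_mul_div_ne_one hk0 hk
      rw [← hxd, ← sub_eq_zero.mp h, one_pow]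
    simp_rw [hpow]
    rw [← hxd, ← mul_neg_geom_sum x d]
    field_simp

lemma sum_conj_zeta_mul_zeta {n d j j' k : ℕ} (hk : k < 2 * n) (hj : j < d) (hj' : j' < d) :
    ∑ m ∈ Finset.range d, (starRingEnd ℂ) (zeta n d j k m) * zeta n d j' k m =
      if j = j' then 1 else 0 := by
  have hd : (d : ℂ) ≠ 0 := Nat.cast_ne_zero.mpr (by omega)
  have hterm : ∀ m ∈ Finset.range d,
      (starRingEnd ℂ) (zeta n d j k m) * zeta n d j' k m =
        1 / (d : ℂ) ^ 2 * ∑ l ∈ Finset.range d, ∑ l' ∈ Finset.range d,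
          Complex.exp (2 * Real.pi * Complex.I / d *
            ((k : ℂ) / (2 * n) * ((l' : ℂ) - l) + j * l - j' * l')) *
          Complex.exp (2 * Real.pi * Complex.I / d * (((l' : ℂ) - (l : ℂ)) * (m : ℂ))) := by
    intro m hm
    have hm := Finset.mem_range.mp hm
    rw [zeta_eq_sum_exp hk hj hm, zeta_eq_sum_exp hk hj' hm, map_mul, map_sum,
      mul_mul_mul_comm, Finset.sum_mul_sum]
    congr 1
    · simp [sq]
    · refine Finset.sum_congr rfl fun l _ => Finset.sum_congr rfl fun l' _ => ?_
      rw [← Complex.exp_conj, ← Complex.exp_add, ← Complex.exp_add]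
      congr 1
      simp only [map_mul, map_div₀, map_add, map_sub, map_natCast, Complex.conj_ofReal,
        Complex.conj_I, map_ofNat]
      ring
  rw [Finset.sum_congr rfl hterm, ← Finset.mul_sum, Finset.sum_comm]
  have hinner : ∀ l ∈ Finset.range d, ∑ m ∈ Finset.range d, ∑ l' ∈ Finset.range d,
      Complex.exp (2 * Real.pi * Complex.I / d *
        ((k : ℂ) / (2 * n) * ((l' : ℂ) - l) + j * l - j' * l')) *
      Complex.exp (2 * Real.pi * Complex.I / d * (((l' : ℂ) - (l : ℂ)) * (m : ℂ))) =
      Complex.exp (2 * Real.pi * Complex.I / d * (((j : ℂ) - (j' : ℂ)) * (l : ℂ))) * d := by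
    intro l hl
    rw [Finset.sum_comm, Finset.sum_eq_single_of_mem l hl]
    · rw [← Finset.mul_sum,
        sum_range_exp_sub_mul d l l (Finset.mem_range.mp hl) (Finset.mem_range.mp hl), if_pos rfl]
      congr 2
      ring
    · intro l' hl' hne
      rw [← Finset.mul_sum,
        sum_range_exp_sub_mul d l' l (Finset.mem_range.mp hl') (Finset.mem_range.mp hl),
        if_neg hne, mul_zero]
  rw [Finset.sum_congr rfl hinner, ← Finset.sum_mul, sum_range_exp_sub_mul d j j' hj hj']
  split_ifs
  · field_simp
  · simp

/-- **Orthonormality of the measurement vectors (Appendix B of the paper).**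
For `n, d ≥ 1` and `k ∈ {0,…,2n−1}`, the vectors `ζ_0^k, …, ζ_{d−1}^k` are
orthonormal in `ℂ^d`: `⟨ζ_j^k, ζ_{j'}^k⟩ = δ_{j,j'}`.  In particular they form
an orthonormal basis of `ℂ^d`. -/
theorem zeta_orthonormal (n d : ℕ) (hn : 1 ≤ n) (hd : 1 ≤ d)
    (k : ℕ) (hk : k < 2 * n) :
    (∀ j < d, ∀ j' < d,
      ∑ m ∈ Finset.range d, (starRingEnd ℂ) (zeta n d j k m) * zeta n d j' k m =
        if j = j' then 1 else 0) ∧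
    ∃ b : OrthonormalBasis (Fin d) ℂ (EuclideanSpace ℂ (Fin d)),
      ∀ j m : Fin d, b j m = zeta n d j k m := by
  refine ⟨fun j hj j' hj' => sum_conj_zeta_mul_zeta hk hj hj', ?_⟩
  let v : Fin d → EuclideanSpace ℂ (Fin d) := fun j => WithLp.toLp 2 fun m => zeta n d j k m
  have hv : Orthonormal ℂ v := by
    rw [orthonormal_iff_ite]
    intro i j
    have h := sum_conj_zeta_mul_zeta hk i.isLt j.isLt
    rw [Finset.sum_range] at h
    simpa [v, PiLp.inner_apply, mul_comm, Fin.ext_iff] using h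
  have hspan : Submodule.span ℂ (Set.range v) = ⊤ :=
    hv.linearIndependent.span_eq_top_of_card_eq_finrank' (by simp)
  exact ⟨OrthonormalBasis.mk hv hspan.ge, fun j m => by simp [v]⟩
end
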